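/- arXiv:2006.12674 — 5 statements merged into one kernel-verified Lean document; each statement's English description precedes it below -/
import Mathlib

section
/- Suppose ‖x̃_i − x̂_i‖ ≤ δ_x for all i = 1, …, n, for some δ_x ≥ 0. Then |f̃ − f| ≤ 2√(f̃) · δ_x + δ_x². -/
theorem abs_sq_sub_sq_le_of_abs_sub_le {a b δ : ℝ} (ha : 0 ≤ a) (hb : 0 ≤ b)
    (h : |a - b| ≤ δ) : |a ^ 2 - b ^ 2| ≤ 2 * a * δ + δ ^ 2 := by
  obtain ⟨h₁, h₂⟩ := abs_le.mp h
  have hδ : 0 ≤ δ := (abs_nonneg _).trans h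
  rw [abs_le]
  constructor
  · nlinarith
  · rcases le_total a b with hab | hab
    · nlinarith [mul_nonneg ha hδ]
    · nlinarith [mul_nonneg (sub_nonneg.mpr hab) ha, mul_nonneg ha (sub_nonneg.mpr h₂)]

theorem mean_le_sqrt_mean_sq {n : ℕ} (hn : 0 < n) (a : Fin n → ℝ) :
    (1 / n : ℝ) * ∑ i, a i ≤ Real.sqrt ((1 / n : ℝ) * ∑ i, a i ^ 2) := by
  have hn' : (0 : ℝ) < n := Nat.cast_pos.mpr hn
  apply Real.le_sqrt_of_sq_le
  have key : (∑ i, a i) ^ 2 ≤ n * ∑ i, a i ^ 2 := by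
    simpa using sq_sum_le_card_mul_sum_sq (s := Finset.univ) (f := a)
  calc ((1 / n : ℝ) * ∑ i, a i) ^ 2 = (1 / n : ℝ) ^ 2 * (∑ i, a i) ^ 2 := mul_pow _ _ _
    _ ≤ (1 / n : ℝ) ^ 2 * (n * ∑ i, a i ^ 2) := by gcongr
    _ = (1 / n : ℝ) * ∑ i, a i ^ 2 := by field_simp

/-- If ‖x̃ᵢ − x̂ᵢ‖ ≤ δₓ for all i, then |f̃ − f| ≤ 2√(f̃)·δₓ + δₓ². -/
theorem inexact_eval_bound_tilde (d n : ℕ) (hn : 0 < n)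
    (x xh xt : Fin n → EuclideanSpace ℝ (Fin d)) (δx : ℝ) (hδx : 0 ≤ δx)
    (h : ∀ i, ‖xt i - xh i‖ ≤ δx) :
    |(1 / n : ℝ) * ∑ i, ‖xt i - x i‖ ^ 2 - (1 / n : ℝ) * ∑ i, ‖xh i - x i‖ ^ 2|
      ≤ 2 * Real.sqrt ((1 / n : ℝ) * ∑ i, ‖xt i - x i‖ ^ 2) * δx + δx ^ 2 := by
  have hn' : (0 : ℝ) < n := Nat.cast_pos.mpr hn
  have term (i : Fin n) : |‖xt i - x i‖ ^ 2 - ‖xh i - x i‖ ^ 2|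
      ≤ 2 * ‖xt i - x i‖ * δx + δx ^ 2 := by
    refine abs_sq_sub_sq_le_of_abs_sub_le (norm_nonneg _) (norm_nonneg _) ?_
    refine (abs_norm_sub_norm_le _ _).trans ?_
    simpa using h i
  rw [← mul_sub, ← Finset.sum_sub_distrib, abs_mul, abs_of_pos (one_div_pos.mpr hn')]
  calc (1 / n : ℝ) * |∑ i, (‖xt i - x i‖ ^ 2 - ‖xh i - x i‖ ^ 2)|
      ≤ (1 / n : ℝ) * ∑ i, (2 * ‖xt i - x i‖ * δx + δx ^ 2) := by
        gcongr
        exact (Finset.abs_sum_le_sum_abs _ _).trans (Finset.sum_le_sum fun i _ => term i)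
    _ = 2 * ((1 / n : ℝ) * ∑ i, ‖xt i - x i‖) * δx + δx ^ 2 := by
        rw [Finset.sum_add_distrib, ← Finset.sum_mul, ← Finset.mul_sum]
        simp only [Finset.sum_const, Finset.card_univ, Fintype.card_fin, nsmul_eq_mul]
        field_simp
    _ ≤ _ := by
        gcongr
        exact mean_le_sqrt_mean_sq hn _
end

section
/- Let δ_f ≥ 0 and suppose ‖x̃_i − x̂_i‖ ≤ √(f̃ + δ_f) − √(f̃) for all i = 1, …, n. Then |f̃ − f| ≤ δ_f. -/
/-- Moving each entry of `a` by at most `e` moves the mean square by at most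
`2 * e * RMS(a) + e ^ 2`. -/
theorem abs_mean_sq_sub_mean_sq_le {n : ℕ} (hn : 0 < n) (a b : Fin n → ℝ)
    (ha : ∀ i, 0 ≤ a i) {e : ℝ} (he : 0 ≤ e) (hab : ∀ i, |a i - b i| ≤ e) :
    |(1 / n : ℝ) * ∑ i, a i ^ 2 - (1 / n : ℝ) * ∑ i, b i ^ 2|
      ≤ 2 * e * Real.sqrt ((1 / n : ℝ) * ∑ i, a i ^ 2) + e ^ 2 := by
  have hn' : (0 : ℝ) < n := by exact_mod_cast hn
  have hterm : ∀ i, |a i ^ 2 - b i ^ 2| ≤ 2 * e * a i + e ^ 2 := fun i => by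
    have hi := abs_le.mp (hab i)
    rw [abs_le]
    constructor <;> nlinarith [ha i, hi.1, hi.2]
  calc |(1 / n : ℝ) * ∑ i, a i ^ 2 - (1 / n : ℝ) * ∑ i, b i ^ 2|
      = (1 / n : ℝ) * |∑ i, (a i ^ 2 - b i ^ 2)| := by
        rw [← mul_sub, ← Finset.sum_sub_distrib, abs_mul, abs_of_pos (by positivity)]
    _ ≤ (1 / n : ℝ) * ∑ i, (2 * e * a i + e ^ 2) := by
        gcongr
        exact (Finset.abs_sum_le_sum_abs _ _).trans (Finset.sum_le_sum fun i _ => hterm i)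
    _ = 2 * e * ((1 / n : ℝ) * ∑ i, a i) + e ^ 2 := by
        rw [Finset.sum_add_distrib, ← Finset.mul_sum, Finset.sum_const, Finset.card_univ,
          Fintype.card_fin, nsmul_eq_mul]
        field_simp
    _ ≤ 2 * e * Real.sqrt ((1 / n : ℝ) * ∑ i, a i ^ 2) + e ^ 2 := by
        gcongr
        exact mean_le_sqrt_mean_sq hn a

/-- If ‖x̃ᵢ − x̂ᵢ‖ ≤ √(f̃ + δ_f) − √(f̃) for all i, then |f̃ − f| ≤ δ_f. -/
theorem inexact_eval_accuracy (d n : ℕ) (hn : 0 < n)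
    (x xh xt : Fin n → EuclideanSpace ℝ (Fin d)) (δf : ℝ) (hδf : 0 ≤ δf)
    (h : ∀ i, ‖xt i - xh i‖ ≤
      Real.sqrt ((1 / n : ℝ) * ∑ j, ‖xt j - x j‖ ^ 2 + δf)
        - Real.sqrt ((1 / n : ℝ) * ∑ j, ‖xt j - x j‖ ^ 2)) :
    |(1 / n : ℝ) * ∑ i, ‖xt i - x i‖ ^ 2 - (1 / n : ℝ) * ∑ i, ‖xh i - x i‖ ^ 2| ≤ δf := by
  have hf : 0 ≤ (1 / n : ℝ) * ∑ j, ‖xt j - x j‖ ^ 2 := by positivity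
  have he := (norm_nonneg _).trans (h ⟨0, hn⟩)
  refine (abs_mean_sq_sub_mean_sq_le hn (fun i => ‖xt i - x i‖) (fun i => ‖xh i - x i‖)
    (fun i => norm_nonneg _) he fun i => ?_).trans (le_of_eq ?_)
  · refine (abs_norm_sub_norm_le _ _).trans ?_
    rw [sub_sub_sub_cancel_right]
    exact h i
  · linear_combination Real.sq_sqrt (add_nonneg hf hδf) - Real.sq_sqrt hf
end

section
/- Let M ≥ 0 and δ_f ≥ 0, and suppose f ≤ M and ‖x̃_i − x̂_i‖ ≤ δ_f/(2√(M + δ_f)) for all i = 1, …, n (with the bound interpreted as requiring x̃_i = x̂_i when M = δ_f = 0). Then |f̃ − f| ≤ δ_f. -/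
/-- Young-type perturbation bound for squared norms: if `‖b - a‖ ≤ c * s`, then
`‖b‖ ^ 2` and `‖a‖ ^ 2` differ by at most `(c * s) ^ 2 + c * (‖a‖ ^ 2 + s ^ 2)`. -/
theorem abs_norm_sq_sub_norm_sq_le {E : Type*} [SeminormedAddCommGroup E] {a b : E} {c s : ℝ}
    (hc : 0 ≤ c) (h : ‖b - a‖ ≤ c * s) :
    |‖b‖ ^ 2 - ‖a‖ ^ 2| ≤ (c * s) ^ 2 + c * (‖a‖ ^ 2 + s ^ 2) := by
  have hab := abs_le.mp ((abs_norm_sub_norm_le b a).trans h)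
  have ha := norm_nonneg a
  have hb := norm_nonneg b
  have hcs : 0 ≤ c * s := (norm_nonneg _).trans h
  have young : 2 * (c * s) * ‖a‖ ≤ c * (‖a‖ ^ 2 + s ^ 2) := by
    nlinarith [mul_nonneg hc (sq_nonneg (‖a‖ - s))]
  rw [abs_le]
  constructor
  · nlinarith [mul_nonneg hb hcs, mul_nonneg ha hcs]
  · nlinarith [mul_nonneg hb hcs, mul_nonneg ha hcs]

/-- If f ≤ M and ‖x̃ᵢ − x̂ᵢ‖ ≤ δ_f/(2√(M + δ_f)) for all i
(with Lean's convention 0/0 = 0 forcing x̃ᵢ = x̂ᵢ when M = δ_f = 0),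
then |f̃ − f| ≤ δ_f. -/
theorem inexact_eval_accuracy_uniform (d n : ℕ) (hn : 0 < n)
    (x xh xt : Fin n → EuclideanSpace ℝ (Fin d)) (M δf : ℝ) (hM : 0 ≤ M) (hδf : 0 ≤ δf)
    (hfM : (1 / n : ℝ) * ∑ i, ‖xh i - x i‖ ^ 2 ≤ M)
    (h : ∀ i, ‖xt i - xh i‖ ≤ δf / (2 * Real.sqrt (M + δf))) :
    |(1 / n : ℝ) * ∑ i, ‖xt i - x i‖ ^ 2 - (1 / n : ℝ) * ∑ i, ‖xh i - x i‖ ^ 2| ≤ δf := by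
  obtain ⟨c, hc, hδ, he⟩ : ∃ c : ℝ, 0 ≤ c ∧ δf = 2 * c * (M + δf) ∧
      δf / (2 * Real.sqrt (M + δf)) = c * Real.sqrt (M + δf) := by
    refine ⟨δf / (2 * (M + δf)), by positivity, ?_, ?_⟩
    · rcases hδf.eq_or_lt with h0 | h0
      · simp [← h0]
      · field_simp
    · rcases hδf.eq_or_lt with h0 | h0
      · simp [← h0]
      · have hs : 0 < Real.sqrt (M + δf) := Real.sqrt_pos.mpr (by linarith)
        have hsq := Real.sq_sqrt (add_nonneg hM hδf)
        rw [div_mul_eq_mul_div, div_eq_div_iff (by positivity) (by positivity)]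
        linear_combination (-2 * δf) * hsq
  rw [he] at h
  have hsq := Real.sq_sqrt (add_nonneg hM hδf)
  set s := Real.sqrt (M + δf)
  have hpt : ∀ i, |‖xt i - x i‖ ^ 2 - ‖xh i - x i‖ ^ 2| ≤
      (c * s) ^ 2 + c * (‖xh i - x i‖ ^ 2 + s ^ 2) := fun i ↦
    abs_norm_sq_sub_norm_sq_le hc (by simpa using h i)
  have hn' : (0 : ℝ) < n := by exact_mod_cast hn
  rw [← mul_sub, ← Finset.sum_sub_distrib, abs_mul, abs_of_pos (by positivity)]
  calc (1 / n : ℝ) * |∑ i, (‖xt i - x i‖ ^ 2 - ‖xh i - x i‖ ^ 2)|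
      ≤ (1 / n : ℝ) * ∑ i, ((c * s) ^ 2 + c * (‖xh i - x i‖ ^ 2 + s ^ 2)) := by
        gcongr
        exact (Finset.abs_sum_le_sum_abs _ _).trans (Finset.sum_le_sum fun i _ ↦ hpt i)
    _ = (c * s) ^ 2 + c * ((1 / n : ℝ) * ∑ i, ‖xh i - x i‖ ^ 2 + s ^ 2) := by
        simp only [Finset.sum_add_distrib, ← Finset.mul_sum, Finset.sum_const, Finset.card_univ,
          Fintype.card_fin, nsmul_eq_mul]
        field_simp
    _ ≤ (c * s) ^ 2 + c * (M + s ^ 2) := by gcongr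
    _ ≤ δf := by
        rw [mul_pow, hsq]
        nlinarith [mul_nonneg hc hδf]
end

section
/- Let κ_ef > 0, κ_H ≥ 1, and let η₂, η₁' > 0 satisfy 1 − η₂ − 2η₁' > 0. Let Δ > 0, let g ∈ ℝ^d with g ≠ 0, and let f₀, f_s, m₀, m_s ∈ ℝ satisfy: (i) |f₀ − m₀| ≤ κ_ef Δ² and |f_s − m_s| ≤ κ_ef Δ² (full linearity); (ii) m₀ − m_s ≥ (1/2)‖g‖·min(Δ, ‖g‖/κ_H) (Cauchy decrease); (iii) Δ ≤ c₀‖g‖ where c₀ := min((1 − η₂ − 2η₁')/(4κ_ef), 1/κ_H). Define ρ := (f₀ − f_s)/(m₀ − m_s) and let ρ̃ ∈ ℝ satisfy |ρ̃ − ρ| ≤ 2η₁'. Then ρ̃ ≥ η₂. -/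
/-- Under full linearity, Cauchy decrease and a small enough trust-region
radius Δ ≤ c₀‖g‖, any approximate ratio ρ̃ with |ρ̃ − ρ| ≤ 2η₁' satisfies ρ̃ ≥ η₂. -/
theorem small_delta_implies_success (d : ℕ) (κef κH η2 η1' Δ f0 fs m0 ms ρt : ℝ)
    (g : EuclideanSpace ℝ (Fin d))
    (hκef : 0 < κef) (hκH : 1 ≤ κH) (hη2 : 0 < η2) (hη1' : 0 < η1')
    (hsum : 0 < 1 - η2 - 2 * η1') (hΔ : 0 < Δ) (hg : g ≠ 0)
    (hfl0 : |f0 - m0| ≤ κef * Δ ^ 2) (hfls : |fs - ms| ≤ κef * Δ ^ 2)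
    (hcauchy : m0 - ms ≥ 1 / 2 * ‖g‖ * min Δ (‖g‖ / κH))
    (hΔle : Δ ≤ min ((1 - η2 - 2 * η1') / (4 * κef)) (1 / κH) * ‖g‖)
    (hρt : |ρt - (f0 - fs) / (m0 - ms)| ≤ 2 * η1') :
    η2 ≤ ρt := by
  have hG : 0 < ‖g‖ := norm_pos_iff.mpr hg
  have hΔH : Δ ≤ ‖g‖ / κH := by
    calc Δ ≤ _ := hΔle
      _ ≤ 1 / κH * ‖g‖ := by gcongr; exact min_le_right _ _
      _ = ‖g‖ / κH := by ring
  have hΔef : 4 * κef * Δ ≤ (1 - η2 - 2 * η1') * ‖g‖ := by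
    have h : Δ ≤ (1 - η2 - 2 * η1') / (4 * κef) * ‖g‖ :=
      hΔle.trans (by gcongr; exact min_le_left _ _)
    rw [div_mul_eq_mul_div, le_div_iff₀ (by positivity)] at h
    linarith
  rw [min_eq_left hΔH] at hcauchy
  have hpos : 0 < m0 - ms := lt_of_lt_of_le (by positivity) hcauchy
  have herr : 2 * κef * Δ ^ 2 ≤ (1 - η2 - 2 * η1') * (m0 - ms) := by
    have h₁ := mul_le_mul_of_nonneg_right hΔef hΔ.le
    have h₂ := mul_le_mul_of_nonneg_left hcauchy hsum.le
    linarith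
  have hρ : η2 + 2 * η1' ≤ (f0 - fs) / (m0 - ms) := by
    rw [le_div_iff₀ hpos]
    linarith [(abs_le.mp hfl0).1, (abs_le.mp hfls).2]
  linarith [(abs_le.mp hρt).1]
end

section
/- Let N, m ≥ 1, let D : ℝ^N → (ℝ²)^m be a linear map with components D x = (D_1 x, …, D_m x), let y ∈ ℝ^N, and let α, ν > 0 and ξ > 0. Define Φ : ℝ^N → ℝ by Φ(x) := (1/2)‖x − y‖² + α Σ_{j=1}^m √(‖D_j x‖² + ν²) + (ξ/2)‖x‖². Then Φ is differentiable and ∇Φ is Lipschitz continuous with constant L = 1 + α‖D‖²/ν + ξ, where ‖D‖ is the operator norm of D, i.e. ‖∇Φ(x) − ∇Φ(x')‖ ≤ (1 + α‖D‖²/ν + ξ)‖x − x'‖ for all x, x' ∈ ℝ^N. -/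
/-- The gradient `p ↦ p / √(‖p‖² + ν²)` of the smoothed norm is `1/ν`-Lipschitz. -/
theorem norm_inv_sqrt_smul_sub_le {F : Type*} [NormedAddCommGroup F] [InnerProductSpace ℝ F]
    {ν : ℝ} (hν : 0 < ν) (p q : F) :
    ‖(√(‖p‖ ^ 2 + ν ^ 2))⁻¹ • p - (√(‖q‖ ^ 2 + ν ^ 2))⁻¹ • q‖ ≤ ν⁻¹ * ‖p - q‖ := by
  have hs_ge : ν ≤ √(‖p‖ ^ 2 + ν ^ 2) := Real.le_sqrt_of_sq_le (by nlinarith [sq_nonneg ‖p‖])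
  have ht_ge : ν ≤ √(‖q‖ ^ 2 + ν ^ 2) := Real.le_sqrt_of_sq_le (by nlinarith [sq_nonneg ‖q‖])
  have hs2 : √(‖p‖ ^ 2 + ν ^ 2) ^ 2 = ‖p‖ ^ 2 + ν ^ 2 := Real.sq_sqrt (by positivity)
  have ht2 : √(‖q‖ ^ 2 + ν ^ 2) ^ 2 = ‖q‖ ^ 2 + ν ^ 2 := Real.sq_sqrt (by positivity)
  generalize √(‖p‖ ^ 2 + ν ^ 2) = s at *
  generalize √(‖q‖ ^ 2 + ν ^ 2) = t at *
  have hs : 0 < s := hν.trans_le hs_ge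
  have ht : 0 < t := hν.trans_le ht_ge
  have hp : ‖p‖ ^ 2 = s ^ 2 - ν ^ 2 := by linarith
  have hq : ‖q‖ ^ 2 = t ^ 2 - ν ^ 2 := by linarith
  have key : s⁻¹ * t⁻¹ * ‖p - q‖ ^ 2 - ‖s⁻¹ • p - t⁻¹ • q‖ ^ 2
      = s⁻¹ * t⁻¹ * (s - t) ^ 2 + ν ^ 2 * (s⁻¹ - t⁻¹) ^ 2 := by
    rw [norm_sub_sq_real, norm_sub_sq_real, norm_smul, norm_smul, mul_pow, mul_pow,
      real_inner_smul_left, real_inner_smul_right, hp, hq, Real.norm_eq_abs, Real.norm_eq_abs,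
      sq_abs, sq_abs]
    field_simp
    ring
  have hst : s⁻¹ * t⁻¹ ≤ ν⁻¹ * ν⁻¹ := by gcongr
  have hnonneg : 0 ≤ s⁻¹ * t⁻¹ * (s - t) ^ 2 + ν ^ 2 * (s⁻¹ - t⁻¹) ^ 2 := by positivity
  refine le_of_sq_le_sq ?_ (by positivity)
  calc ‖s⁻¹ • p - t⁻¹ • q‖ ^ 2 ≤ s⁻¹ * t⁻¹ * ‖p - q‖ ^ 2 := by linarith
    _ ≤ ν⁻¹ * ν⁻¹ * ‖p - q‖ ^ 2 := by gcongr
    _ = (ν⁻¹ * ‖p - q‖) ^ 2 := by ring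

/-- The gradient of `p ↦ ∑ j, √(‖p j‖² + ν²)`. -/
noncomputable def smoothedNormGrad {ι F : Type*} [NormedAddCommGroup F] [InnerProductSpace ℝ F]
    (ν : ℝ) (p : PiLp 2 (fun _ : ι => F)) : PiLp 2 (fun _ : ι => F) :=
  WithLp.toLp 2 fun j => (√(‖p j‖ ^ 2 + ν ^ 2))⁻¹ • p j

theorem norm_smoothedNormGrad_sub_le {ι F : Type*} [Fintype ι] [NormedAddCommGroup F]
    [InnerProductSpace ℝ F] {ν : ℝ} (hν : 0 < ν) (p q : PiLp 2 (fun _ : ι => F)) :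
    ‖smoothedNormGrad ν p - smoothedNormGrad ν q‖ ≤ ν⁻¹ * ‖p - q‖ := by
  refine le_of_sq_le_sq ?_ (by positivity)
  rw [mul_pow, PiLp.norm_sq_eq_of_L2, PiLp.norm_sq_eq_of_L2, Finset.mul_sum]
  refine Finset.sum_le_sum fun j _ => ?_
  rw [← mul_pow]
  exact pow_le_pow_left₀ (norm_nonneg _) (norm_inv_sqrt_smul_sub_le hν (p j) (q j)) 2

theorem hasGradientAt_smoothed_rof {ι E F : Type*} [Fintype ι]
    [NormedAddCommGroup E] [InnerProductSpace ℝ E] [CompleteSpace E]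
    [NormedAddCommGroup F] [InnerProductSpace ℝ F] [CompleteSpace F]
    (D : E →L[ℝ] PiLp 2 (fun _ : ι => F)) (y : E) (α ξ : ℝ) {ν : ℝ} (hν : 0 < ν) (x : E) :
    HasGradientAt (fun x => 1 / 2 * ‖x - y‖ ^ 2
        + α * ∑ j, √(‖D x j‖ ^ 2 + ν ^ 2) + ξ / 2 * ‖x‖ ^ 2)
      ((x - y) + α • D.adjoint (smoothedNormGrad ν (D x)) + ξ • x) x := by
  rw [hasGradientAt_iff_hasFDerivAt]
  have h₁ := (((hasFDerivAt_id x).sub_const y).norm_sq).const_mul (1 / 2 : ℝ)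
  have h₃ := ((hasFDerivAt_id x).norm_sq).const_mul (ξ / 2)
  have h₂ := (HasFDerivAt.fun_sum (u := Finset.univ) fun j _ =>
    (((((PiLp.proj 2 (fun _ : ι => F) j).comp D).hasFDerivAt (x := x)).norm_sq).add_const
      (ν ^ 2)).sqrt (by positivity)).const_mul α
  refine ((h₁.add h₂).add h₃).congr_fderiv ?_
  ext v
  simp [smoothedNormGrad, real_inner_smul_left, ContinuousLinearMap.adjoint_inner_left,
    PiLp.inner_apply]
  congr 1
  · congr 2
    exact Finset.sum_congr rfl fun j _ => by ring
  · ring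

/-- The smoothed ROF objective
Φ(x) = (1/2)‖x − y‖² + α Σⱼ √(‖Dⱼx‖² + ν²) + (ξ/2)‖x‖²
is differentiable with (1 + α‖D‖²/ν + ξ)-Lipschitz gradient. -/
theorem smoothed_rof_L_smooth (N m : ℕ) (hN : 1 ≤ N) (hm : 1 ≤ m)
    (D : EuclideanSpace ℝ (Fin N) →L[ℝ] PiLp 2 (fun _ : Fin m => EuclideanSpace ℝ (Fin 2)))
    (y : EuclideanSpace ℝ (Fin N)) (α ν ξ : ℝ) (hα : 0 < α) (hν : 0 < ν) (hξ : 0 < ξ)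
    (Φ : EuclideanSpace ℝ (Fin N) → ℝ)
    (hΦ : ∀ x, Φ x = 1 / 2 * ‖x - y‖ ^ 2
        + α * ∑ j, Real.sqrt (‖D x j‖ ^ 2 + ν ^ 2) + ξ / 2 * ‖x‖ ^ 2) :
    Differentiable ℝ Φ ∧
    (∀ x x', ‖gradient Φ x - gradient Φ x'‖ ≤ (1 + α * ‖D‖ ^ 2 / ν + ξ) * ‖x - x'‖) := by
  have hgrad : ∀ x, HasGradientAt Φ
      ((x - y) + α • D.adjoint (smoothedNormGrad ν (D x)) + ξ • x) x := by
    rw [funext hΦ]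
    exact hasGradientAt_smoothed_rof D y α ξ hν
  refine ⟨fun x => (hgrad x).differentiableAt, fun x x' => ?_⟩
  rw [(hgrad x).gradient, (hgrad x').gradient]
  have hD : ‖D.adjoint (smoothedNormGrad ν (D x) - smoothedNormGrad ν (D x'))‖
      ≤ ‖D‖ * (ν⁻¹ * (‖D‖ * ‖x - x'‖)) := by
    refine (D.adjoint.le_opNorm _).trans ?_
    rw [LinearIsometryEquiv.norm_map]
    gcongr
    refine (norm_smoothedNormGrad_sub_le hν _ _).trans ?_
    rw [← map_sub]
    gcongr
    exact D.le_opNorm _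
  calc _ = ‖(x - x') + α • D.adjoint (smoothedNormGrad ν (D x) - smoothedNormGrad ν (D x'))
          + ξ • (x - x')‖ := by
        rw [map_sub]
        congr 1
        module
    _ ≤ ‖x - x'‖ + α * (‖D‖ * (ν⁻¹ * (‖D‖ * ‖x - x'‖))) + ξ * ‖x - x'‖ := by
        refine norm_add₃_le.trans ?_
        rw [norm_smul, norm_smul, Real.norm_of_nonneg hα.le, Real.norm_of_nonneg hξ.le]
        gcongr
    _ = (1 + α * ‖D‖ ^ 2 / ν + ξ) * ‖x - x'‖ := by ring
end
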